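/- Let F_X, F_Y be fixed univariate margins such that the set 𝔇^{F_X,F_Y} of all bivariate distributions with margins F_X and F_Y is nonempty. Then 𝔇^{F_X,F_Y} is compact in the uniform (sup) metric on bounded functions R̄² → ℝ. -/

import Mathlib

open scoped Classical

noncomputable section

/-- The `F`-volume of the rectangle `[a₁,a₂] × [b₁,b₂]`. -/
def vol (F : EReal × EReal → ℝ) (a₁ a₂ b₁ b₂ : EReal) : ℝ :=
  F (a₂, b₂) - F (a₁, b₂) - F (a₂, b₁) + F (a₁, b₁)

/-- `x ∈ R̄` is an infinite value, i.e. `−∞` or `+∞`. -/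
def IsInfinite (x : EReal) : Prop := x = ⊥ ∨ x = ⊤

/-- A bivariate quasi-distribution on `R̄²`. -/
def IsQuasiDist (F : EReal × EReal → ℝ) : Prop :=
  (∀ p : EReal × EReal, F p ∈ Set.Icc (0:ℝ) 1) ∧
  (∀ x : EReal, F (x, ⊥) = 0) ∧ (∀ y : EReal, F (⊥, y) = 0) ∧
  F (⊤, ⊤) = 1 ∧
  (∀ a₁ a₂ b₁ b₂ : EReal, a₁ ≤ a₂ → b₁ ≤ b₂ →
    (IsInfinite a₁ ∨ IsInfinite a₂ ∨ IsInfinite b₁ ∨ IsInfinite b₂) →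
    0 ≤ vol F a₁ a₂ b₁ b₂)

/-- A bivariate distribution on `R̄²` (no right-continuity assumed). -/
def IsDist (F : EReal × EReal → ℝ) : Prop :=
  (∀ p : EReal × EReal, F p ∈ Set.Icc (0:ℝ) 1) ∧
  (∀ x : EReal, F (x, ⊥) = 0) ∧ (∀ y : EReal, F (⊥, y) = 0) ∧
  F (⊤, ⊤) = 1 ∧
  (∀ a₁ a₂ b₁ b₂ : EReal, a₁ ≤ a₂ → b₁ ≤ b₂ → 0 ≤ vol F a₁ a₂ b₁ b₂)

/-- `F` has margins `FX` and `FY`. -/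
def HasMargins (F : EReal × EReal → ℝ) (FX FY : EReal → ℝ) : Prop :=
  (∀ x, F (x, ⊤) = FX x) ∧ (∀ y, F (⊤, y) = FY y)

/-- A univariate distribution function on `R̄` (no right-continuity assumed). -/
def UnivDist (F : EReal → ℝ) : Prop :=
  Monotone F ∧ F ⊥ = 0 ∧ F ⊤ = 1

/-- A (nondegenerate) rectangle in `R̄²` with distinct standard corners. -/
structure Rect where
  x1 : EReal
  y1 : EReal
  x2 : EReal
  y2 : EReal
  hx : x1 < x2
  hy : y1 < y2

/-- The multiplicity of a point with respect to a rectangle: `+1` at the main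
corners (southwest and northeast), `−1` at the opposite corners. -/
def Rect.mult (R : Rect) (p : EReal × EReal) : ℤ :=
  (if p = (R.x1, R.y1) then 1 else 0) + (if p = (R.x2, R.y2) then 1 else 0)
    - (if p = (R.x2, R.y1) then 1 else 0) - (if p = (R.x1, R.y2) then 1 else 0)

/-- The interior of a rectangle, as a subset of `R̄²`. -/
def Rect.inter (R : Rect) : Set (EReal × EReal) :=
  Set.Ioo R.x1 R.x2 ×ˢ Set.Ioo R.y1 R.y2

/-- The image of a rectangle under the reflection `δ(x,y) = (−x,y)`. -/
def Rect.reflect (R : Rect) : Rect where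
  x1 := -R.x2
  y1 := R.y1
  x2 := -R.x1
  y2 := R.y2
  hx := EReal.neg_lt_neg_iff.mpr R.hx
  hy := R.hy

/-- A finite (formal) union of rectangles is represented by a list; membership in `ℜ`
additionally requires pairwise disjointness, see `disjU`. -/
def disjU (U : List Rect) : Prop :=
  U.Pairwise fun R S => Disjoint R.inter S.inter

/-- The multiplicity of a point with respect to a finite union of rectangles. -/
def multU (U : List Rect) (p : EReal × EReal) : ℤ :=
  (U.map fun R => R.mult p).sum

/-- The corners of a rectangle, as a list. -/
def Rect.cornerList (R : Rect) : List (EReal × EReal) :=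
  [(R.x1, R.y1), (R.x2, R.y2), (R.x2, R.y1), (R.x1, R.y2)]

/-- The set of corners of a finite union of rectangles. -/
def cornersU (U : List Rect) : Finset (EReal × EReal) :=
  (U.flatMap Rect.cornerList).toFinset

/-- `L^{(A,B)}(R) = Σ_{m_R(y)>0} B(y)·m_R(y) + Σ_{m_R(y)<0} A(y)·m_R(y)`. -/
def Lval (A B : EReal × EReal → ℝ) (U : List Rect) : ℝ :=
  ∑ p ∈ cornersU U,
    (if 0 < multU U p then B p * (multU U p : ℝ)
     else if multU U p < 0 then A p * (multU U p : ℝ) else 0)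

/-- Condition (Q1): `A ≤ B` pointwise. -/
def CondQ1 (A B : EReal × EReal → ℝ) : Prop := ∀ p, A p ≤ B p

/-- Condition (Q2): `L^{(A,B)}(R) ≥ 0` for all `R ∈ ℜ`. -/
def CondQ2 (A B : EReal × EReal → ℝ) : Prop :=
  ∀ U : List Rect, disjU U → 0 ≤ Lval A B U

/-- `P_O^{(A,B)}(x) = inf { L^{(A,B)}(R)/(−m_R(x)) : R ∈ ℜ, m_R(x) < 0 }`,
with the infimum of the empty set being `+∞`. -/
def PO (A B : EReal × EReal → ℝ) (x : EReal × EReal) : EReal :=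
  ⨅ U : {U : List Rect // disjU U ∧ multU U x < 0},
    ((Lval A B U.1 / (-(multU U.1 x) : ℝ) : ℝ) : EReal)

/-- `P_M^{(A,B)}(x) = inf { L^{(A,B)}(R)/m_R(x) : R ∈ ℜ, m_R(x) > 0 }`,
with the infimum of the empty set being `+∞`. -/
def PM (A B : EReal × EReal → ℝ) (x : EReal × EReal) : EReal :=
  ⨅ U : {U : List Rect // disjU U ∧ 0 < multU U x},
    ((Lval A B U.1 / ((multU U.1 x) : ℝ) : ℝ) : EReal)

/-- `γ^{(A,B)}(x) = min { P_O^{(A,B)}(x), B(x) − A(x) }`. -/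
def gammaAB (A B : EReal × EReal → ℝ) (x : EReal × EReal) : EReal :=
  min (PO A B x) ((B x - A x : ℝ) : EReal)

/-- A quasi-copula on `[0,1]²`. -/
def IsQuasiCopula (Q : ℝ → ℝ → ℝ) : Prop :=
  (∀ u ∈ Set.Icc (0:ℝ) 1, ∀ v ∈ Set.Icc (0:ℝ) 1, Q u v ∈ Set.Icc (0:ℝ) 1) ∧
  (∀ u ∈ Set.Icc (0:ℝ) 1, Q u 0 = 0 ∧ Q 0 u = 0 ∧ Q u 1 = u ∧ Q 1 u = u) ∧
  (∀ u ∈ Set.Icc (0:ℝ) 1, ∀ u' ∈ Set.Icc (0:ℝ) 1, ∀ v ∈ Set.Icc (0:ℝ) 1,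
    u ≤ u' → Q u v ≤ Q u' v ∧ Q v u ≤ Q v u') ∧
  (∀ u ∈ Set.Icc (0:ℝ) 1, ∀ u' ∈ Set.Icc (0:ℝ) 1, ∀ v ∈ Set.Icc (0:ℝ) 1,
    ∀ v' ∈ Set.Icc (0:ℝ) 1, |Q u v - Q u' v'| ≤ |u - u'| + |v - v'|)

/-- A copula on `[0,1]²`. -/
def IsCopula (C : ℝ → ℝ → ℝ) : Prop :=
  (∀ u ∈ Set.Icc (0:ℝ) 1, ∀ v ∈ Set.Icc (0:ℝ) 1, C u v ∈ Set.Icc (0:ℝ) 1) ∧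
  (∀ u ∈ Set.Icc (0:ℝ) 1, C u 0 = 0 ∧ C 0 u = 0 ∧ C u 1 = u ∧ C 1 u = u) ∧
  (∀ u₁ ∈ Set.Icc (0:ℝ) 1, ∀ u₂ ∈ Set.Icc (0:ℝ) 1, ∀ v₁ ∈ Set.Icc (0:ℝ) 1,
    ∀ v₂ ∈ Set.Icc (0:ℝ) 1, u₁ ≤ u₂ → v₁ ≤ v₂ →
    0 ≤ C u₂ v₂ - C u₁ v₂ - C u₂ v₁ + C u₁ v₁)

/-- `𝒞(P,Q)`: the set of copulas lying pointwise between `P` and `Q` on `[0,1]²`. -/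
def Cset (P Q : ℝ → ℝ → ℝ) : Set (ℝ → ℝ → ℝ) :=
  {C | IsCopula C ∧ ∀ u ∈ Set.Icc (0:ℝ) 1, ∀ v ∈ Set.Icc (0:ℝ) 1,
    P u v ≤ C u v ∧ C u v ≤ Q u v}

/-- `(P,Q)` is a coherent imprecise copula. -/
def CoherentImprecise (P Q : ℝ → ℝ → ℝ) : Prop :=
  IsQuasiCopula P ∧ IsQuasiCopula Q ∧
  (∀ u ∈ Set.Icc (0:ℝ) 1, ∀ v ∈ Set.Icc (0:ℝ) 1, P u v ≤ Q u v) ∧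
  (Cset P Q).Nonempty ∧
  (∀ u ∈ Set.Icc (0:ℝ) 1, ∀ v ∈ Set.Icc (0:ℝ) 1,
    P u v = sInf ((fun C => C u v) '' Cset P Q) ∧
    Q u v = sSup ((fun C => C u v) '' Cset P Q))

/-- `𝔇(A,B)`: the set of bivariate distributions with margins `FX`, `FY`
lying pointwise between `A` and `B`. -/
def Dset (FX FY : EReal → ℝ) (A B : EReal × EReal → ℝ) : Set (EReal × EReal → ℝ) :=
  {F | IsDist F ∧ HasMargins F FX FY ∧ ∀ p, A p ≤ F p ∧ F p ≤ B p}

/-- The pointwise infimum of a set of bivariate functions. -/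
def pinf (S : Set (EReal × EReal → ℝ)) : EReal × EReal → ℝ :=
  fun p => sInf ((fun F => F p) '' S)

/-- The pointwise supremum of a set of bivariate functions. -/
def psup (S : Set (EReal × EReal → ℝ)) : EReal × EReal → ℝ :=
  fun p => sSup ((fun F => F p) '' S)

/-- `S` is a coherent restricted bivariate `p`-box with margins `FX`, `FY`. -/
def CoherentPBox (FX FY : EReal → ℝ) (S : Set (EReal × EReal → ℝ)) : Prop :=
  S.Nonempty ∧ (∀ F ∈ S, IsDist F ∧ HasMargins F FX FY) ∧
  S = Dset FX FY (pinf S) (psup S) ∧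
  (∀ p, pinf S p = pinf (Dset FX FY (pinf S) (psup S)) p) ∧
  (∀ p, psup S p = psup (Dset FX FY (pinf S) (psup S)) p)

/-- A mesh `Δ = δ_x × δ_y`. -/
structure Mesh where
  sx : Finset EReal
  sy : Finset EReal
  botx : ⊥ ∈ sx
  topx : ⊤ ∈ sx
  boty : ⊥ ∈ sy
  topy : ⊤ ∈ sy
  posx : ∃ a ∈ sx, 0 < a ∧ a ≠ ⊤
  negx : ∃ a ∈ sx, a < 0 ∧ a ≠ ⊥
  posy : ∃ a ∈ sy, 0 < a ∧ a ≠ ⊤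
  negy : ∃ a ∈ sy, a < 0 ∧ a ≠ ⊥

/-- A discrete bivariate quasi-distribution on the mesh `Δ`. -/
def DiscQuasiDist (Δ : Mesh) (F : EReal × EReal → ℝ) : Prop :=
  (∀ x ∈ Δ.sx, ∀ y ∈ Δ.sy, F (x, y) ∈ Set.Icc (0:ℝ) 1) ∧
  (∀ x ∈ Δ.sx, F (x, ⊥) = 0) ∧ (∀ y ∈ Δ.sy, F (⊥, y) = 0) ∧
  F (⊤, ⊤) = 1 ∧
  (∀ a₁ ∈ Δ.sx, ∀ a₂ ∈ Δ.sx, ∀ b₁ ∈ Δ.sy, ∀ b₂ ∈ Δ.sy, a₁ ≤ a₂ → b₁ ≤ b₂ →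
    (IsInfinite a₁ ∨ IsInfinite a₂ ∨ IsInfinite b₁ ∨ IsInfinite b₂) →
    0 ≤ vol F a₁ a₂ b₁ b₂)

/-- A discrete bivariate distribution on the mesh `Δ`. -/
def DiscDist (Δ : Mesh) (F : EReal × EReal → ℝ) : Prop :=
  (∀ x ∈ Δ.sx, ∀ y ∈ Δ.sy, F (x, y) ∈ Set.Icc (0:ℝ) 1) ∧
  (∀ x ∈ Δ.sx, F (x, ⊥) = 0) ∧ (∀ y ∈ Δ.sy, F (⊥, y) = 0) ∧
  F (⊤, ⊤) = 1 ∧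
  (∀ a₁ ∈ Δ.sx, ∀ a₂ ∈ Δ.sx, ∀ b₁ ∈ Δ.sy, ∀ b₂ ∈ Δ.sy, a₁ ≤ a₂ → b₁ ≤ b₂ →
    0 ≤ vol F a₁ a₂ b₁ b₂)

/-- All rectangles of the union have their corners in the mesh `Δ`. -/
def inMeshU (Δ : Mesh) (U : List Rect) : Prop :=
  ∀ R ∈ U, R.x1 ∈ Δ.sx ∧ R.x2 ∈ Δ.sx ∧ R.y1 ∈ Δ.sy ∧ R.y2 ∈ Δ.sy

/-- The reflection `A^δ(x,y) = F_Y(y) − A(−x,y)` of `A` having second margin `FY`. -/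
def reflectFun (FY : EReal → ℝ) (A : EReal × EReal → ℝ) : EReal × EReal → ℝ :=
  fun p => FY p.2 - A (-p.1, p.2)

end

theorem IsDist.abs_sub_fst_le {F : EReal × EReal → ℝ} {FX FY : EReal → ℝ} (hF : IsDist F)
    (hm : HasMargins F FX FY) (x x' y : EReal) :
    |F (x, y) - F (x', y)| ≤ |FX x - FX x'| := by
  obtain ⟨-, hb, -, -, hv⟩ := hF
  wlog h : x ≤ x' generalizing x x'
  · rw [abs_sub_comm, abs_sub_comm (FX x)]
    exact this x' x (le_of_not_ge h)
  have h₁ := hv x x' ⊥ y h bot_le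
  have h₂ := hv x x' y ⊤ h le_top
  simp only [vol, hb, hm.1] at h₁ h₂
  rw [abs_sub_comm, abs_sub_comm (FX x)]
  exact abs_le_abs_of_nonneg (by linarith) (by linarith)

theorem IsDist.abs_sub_snd_le {F : EReal × EReal → ℝ} {FX FY : EReal → ℝ} (hF : IsDist F)
    (hm : HasMargins F FX FY) (x y y' : EReal) :
    |F (x, y) - F (x, y')| ≤ |FY y - FY y'| := by
  obtain ⟨-, -, hb, -, hv⟩ := hF
  wlog h : y ≤ y' generalizing y y'
  · rw [abs_sub_comm, abs_sub_comm (FY y)]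
    exact this y' y (le_of_not_ge h)
  have h₁ := hv ⊥ x y y' bot_le h
  have h₂ := hv x ⊤ y y' le_top h
  simp only [vol, hb, hm.2] at h₁ h₂
  rw [abs_sub_comm, abs_sub_comm (FY y)]
  exact abs_le_abs_of_nonneg (by linarith) (by linarith)

theorem IsDist.abs_sub_le {F : EReal × EReal → ℝ} {FX FY : EReal → ℝ} (hF : IsDist F)
    (hm : HasMargins F FX FY) (p q : EReal × EReal) :
    |F p - F q| ≤ |FX p.1 - FX q.1| + |FY p.2 - FY q.2| :=
  (_root_.abs_sub_le (F p) (F (q.1, p.2)) (F q)).trans <|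
    add_le_add (hF.abs_sub_fst_le hm p.1 q.1 p.2) (hF.abs_sub_snd_le hm q.1 p.2 q.2)

/-- The set of distributions with given margins is compact for pointwise convergence. -/
theorem isCompact_setOf_isDist_hasMargins (FX FY : EReal → ℝ) :
    IsCompact {F : EReal × EReal → ℝ | IsDist F ∧ HasMargins F FX FY} := by
  refine (isCompact_univ_pi fun _ : EReal × EReal => isCompact_Icc (a := (0 : ℝ)) (b := 1))
    |>.of_isClosed_subset ?_ fun F hF p _ => hF.1.1 p
  have hc (p : EReal × EReal) : Continuous fun F : EReal × EReal → ℝ => F p := continuous_apply p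
  simp only [IsDist, HasMargins, vol, Set.ofPred_and, Set.ofPred_forall]
  refine .inter (.inter ?_ (.inter ?_ (.inter ?_ (.inter ?_ ?_)))) (.inter ?_ ?_)
  · exact isClosed_iInter fun p => isClosed_Icc.preimage (hc p)
  · exact isClosed_iInter fun x => isClosed_eq (hc _) continuous_const
  · exact isClosed_iInter fun x => isClosed_eq (hc _) continuous_const
  · exact isClosed_eq (hc _) continuous_const
  · exact isClosed_iInter fun a₁ => isClosed_iInter fun a₂ => isClosed_iInter fun b₁ =>
      isClosed_iInter fun b₂ => isClosed_iInter fun _ => isClosed_iInter fun _ =>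
        isClosed_le continuous_const
          ((((hc _).sub (hc _)).sub (hc _)).add (hc _))
  · exact isClosed_iInter fun x => isClosed_eq (hc _) continuous_const
  · exact isClosed_iInter fun x => isClosed_eq (hc _) continuous_const

/-- The pairs of marginal values can be approximated by those at finitely many points. -/
theorem exists_finite_margin_net {F : EReal × EReal → ℝ} {FX FY : EReal → ℝ} (hF : IsDist F)
    (hm : HasMargins F FX FY) {ε : ℝ} (hε : 0 < ε) :
    ∃ t : Set (EReal × EReal), t.Finite ∧
      ∀ p : EReal × EReal, ∃ q ∈ t, |FX p.1 - FX q.1| < ε ∧ |FY p.2 - FY q.2| < ε := by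
  let g : EReal × EReal → ℝ × ℝ := fun p => (FX p.1, FY p.2)
  have hg : TotallyBounded (Set.range g) := by
    refine (isCompact_Icc (a := (0 : ℝ)) (b := 1) |>.prod
      (isCompact_Icc (a := (0 : ℝ)) (b := 1))).totallyBounded.subset ?_
    rintro _ ⟨p, rfl⟩
    simp only [g, ← hm.1, ← hm.2]
    exact ⟨hF.1 _, hF.1 _⟩
  obtain ⟨s, hs, hfin, hcov⟩ := Metric.finite_approx_of_totallyBounded hg ε hε
  choose! h hh using fun y (hy : y ∈ s) => Set.mem_range.1 (hs hy)
  refine ⟨h '' s, hfin.image h, fun p => ?_⟩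
  obtain ⟨y, hy, hpy⟩ := Set.mem_iUnion₂.1 (hcov ⟨p, rfl⟩)
  rw [← hh y hy, Metric.mem_ball, Prod.dist_eq, max_lt_iff, Real.dist_eq, Real.dist_eq] at hpy
  exact ⟨h y, ⟨y, hy, rfl⟩, hpy⟩

/-- The set `𝔇^{F_X,F_Y}` of distributions with fixed margins is compact in the
topology of uniform convergence (the uniform/sup metric). -/
theorem dist_set_isCompact (FX FY : EReal → ℝ)
    (hne : ∃ F : EReal × EReal → ℝ, IsDist F ∧ HasMargins F FX FY) :
    IsCompact {F : UniformFun (EReal × EReal) ℝ |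
      IsDist (UniformFun.toFun F) ∧ HasMargins (UniformFun.toFun F) FX FY} := by
  refine isCompact_iff_ultrafilter_le_nhds.2 fun u hu => ?_
  rw [Filter.le_principal_iff] at hu
  obtain ⟨F, hF, hlim⟩ := isCompact_iff_ultrafilter_le_nhds.1
    (isCompact_setOf_isDist_hasMargins FX FY) (u.map UniformFun.toFun)
    (Filter.le_principal_iff.2 hu)
  refine ⟨UniformFun.ofFun F, hF, ?_⟩
  have hpt : ∀ p, Filter.Tendsto (fun G : UniformFun (EReal × EReal) ℝ => UniformFun.toFun G p)
      u (nhds (F p)) := tendsto_pi_nhds.1 hlim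
  change Filter.Tendsto id (u : Filter (UniformFun (EReal × EReal) ℝ)) _
  rw [UniformFun.tendsto_iff_tendstoUniformly, Metric.tendstoUniformly_iff]
  intro ε hε
  obtain ⟨F₀, hF₀, hm₀⟩ := hne
  obtain ⟨t, ht, hnet⟩ := exists_finite_margin_net hF₀ hm₀ (ε := ε / 5) (by positivity)
  have hev := (Filter.eventually_all_finite ht).2 fun q _ =>
    Metric.tendsto_nhds.1 (hpt q) (ε / 5) (by positivity)
  filter_upwards [hu, hev] with G hG hGt p
  obtain ⟨q, hq, hx, hy⟩ := hnet p
  have h₁ := hF.1.abs_sub_le hF.2 p q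
  have h₂ := hG.1.abs_sub_le hG.2 p q
  have h₃ := hGt q hq
  simp only [Real.dist_eq, Function.comp_apply, id] at h₃ ⊢
  change |F p - UniformFun.toFun G p| < ε
  rw [abs_le] at h₁ h₂
  rw [abs_lt] at h₃ ⊢
  constructor <;> linarith [h₁.1, h₁.2, h₂.1, h₂.2, h₃.1, h₃.2]
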